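/- arXiv:2303.12514 — 7 statements merged into one kernel-verified Lean document; each statement's English description precedes it below -/
import Mathlib

section
/- For any nontrivial Pythagorean triple, i.e., positive integers $a, b, c$ with $a^2 + b^2 = c^2$ and $a \neq 0$, $b \neq 0$, the complex number $\frac{a+bi}{c}$ is not a root of unity: there is no positive integer $n$ with $\left(\frac{a+bi}{c}\right)^n = 1$. -/
open Complex

/-- Twice a positive proper fraction `x / c` can only be an algebraic integer if it equals `1`. -/
lemma two_mul_eq_of_isIntegral {x c : ℕ} (hx : 0 < x) (hxc : x < c)
    (hint : IsIntegral ℤ (2 * (x : ℂ) / c)) : 2 * x = c := by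
  have hc : (c : ℂ) ≠ 0 := by exact_mod_cast (hx.trans hxc).ne'
  obtain ⟨k, hk⟩ := hint.exists_int_iff_exists_rat.mp ⟨2 * x / c, by push_cast; rfl⟩
  have hkc : 2 * (x : ℤ) = k * c := by
    rw [div_eq_iff hc] at hk
    exact_mod_cast hk
  have hk1 : k = 1 := by
    have h0 : 0 < k := by by_contra! hk0; nlinarith
    have h2 : k < 2 := by by_contra! hk2; nlinarith
    omega
  subst hk1
  omega

theorem stmt_1 (a b c : ℕ) (ha : 0 < a) (hb : 0 < b) (hc : 0 < c)
    (h : a ^ 2 + b ^ 2 = c ^ 2) :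
    ¬ ∃ n : ℕ, 0 < n ∧ (((a : ℂ) + (b : ℂ) * I) / (c : ℂ)) ^ n = 1 := by
  rintro ⟨n, hn, hz⟩
  have hw : (((a : ℂ) - (b : ℂ) * I) / (c : ℂ)) ^ n = 1 := by
    simpa [sub_eq_add_neg] using congrArg (starRingEnd ℂ) hz
  have hzi : IsIntegral ℤ (((a : ℂ) + (b : ℂ) * I) / c) := .of_pow hn (hz ▸ isIntegral_one)
  have hwi : IsIntegral ℤ (((a : ℂ) - (b : ℂ) * I) / c) := .of_pow hn (hw ▸ isIntegral_one)
  have hac : 2 * a = c := two_mul_eq_of_isIntegral ha (by nlinarith) <| by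
    have key : 2 * (a : ℂ) / c = ((a : ℂ) + b * I) / c + ((a : ℂ) - b * I) / c := by ring
    exact key ▸ hzi.add hwi
  have hbc : 2 * b = c := two_mul_eq_of_isIntegral hb (by nlinarith) <| by
    have key : 2 * (b : ℂ) / c = (((a : ℂ) - b * I) / c - ((a : ℂ) + b * I) / c) * I := by
      linear_combination (2 * (b : ℂ) / c) * I_sq
    exact key ▸ (hwi.sub hzi).mul isIntegral_int_I
  nlinarith
end

section
/- The Galois group of the polynomial $5x^6 - 6x^3 + 5$ over the rational numbers is not abelian: there exist elements $\sigma, \tau$ of the Galois group of its splitting field over $\mathbb{Q}$ with $\sigma\tau \neq \tau\sigma$. -/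
open Polynomial

/-- In a Galois extension with commutative Galois group, an automorphism fixing one of two
conjugate elements fixes the other. -/
theorem apply_eq_of_isConjRoot_of_commute {K L : Type*} [Field K] [Field L] [Algebra K L]
    [Normal K L] (hcomm : ∀ σ τ : L ≃ₐ[K] L, σ * τ = τ * σ) {x y : L}
    (hxy : IsConjRoot K x y) {σ : L ≃ₐ[K] L} (hx : σ x = x) : σ y = y := by
  obtain ⟨ρ, hρ⟩ := isConjRoot_iff_exists_algEquiv.mp hxy.symm
  have h := DFunLike.congr_fun (hcomm σ ρ) x
  simp only [AlgEquiv.mul_apply, hx] at h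
  rwa [hρ] at h

theorem irreducible_X_pow_three_sub :
    Irreducible (X ^ 3 - C 3 * X - C (6 / 5) : ℚ[X]) := by
  have hm : (X ^ 3 - C 3 * X - C (6 / 5) : ℚ[X]).natDegree = 3 := by compute_degree!
  rw [irreducible_iff_roots_eq_zero_of_degree_le_three (by rw [hm]; norm_num) hm.le]
  refine Multiset.eq_zero_of_forall_notMem fun r hr => ?_
  have hr' : r ^ 3 - 3 * r - 6 / 5 = 0 := by
    simpa using isRoot_of_mem_roots hr
  have hd : (r.den : ℚ) ≠ 0 := by exact_mod_cast r.den_nz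
  have key : 5 * (r.num : ℚ) ^ 3 = 15 * r.num * r.den ^ 2 + 6 * r.den ^ 3 := by
    rw [← Rat.num_div_den r] at hr'
    field_simp at hr'
    linear_combination hr'
  have keyZ : 5 * r.num ^ 3 = 15 * r.num * (r.den : ℤ) ^ 2 + 6 * (r.den : ℤ) ^ 3 := by
    exact_mod_cast key
  have hp : Prime (3 : ℤ) := Int.prime_three
  have h3 : (3 : ℤ) ∣ r.num := by
    have : (3 : ℤ) ∣ 5 * r.num ^ 3 := by
      rw [keyZ]
      exact ⟨5 * r.num * (r.den : ℤ) ^ 2 + 2 * (r.den : ℤ) ^ 3, by ring⟩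
    rcases hp.dvd_or_dvd this with h | h
    · norm_num at h
    · exact hp.dvd_of_dvd_pow h
  obtain ⟨k, hk⟩ := h3
  have h3d : (3 : ℤ) ∣ r.den := by
    have : (3 : ℤ) ∣ 2 * (r.den : ℤ) ^ 3 := by
      refine ⟨15 * k ^ 3 - 5 * k * (r.den : ℤ) ^ 2, ?_⟩
      rw [hk] at keyZ
      linarith
    rcases hp.dvd_or_dvd this with h | h
    · norm_num at h
    · exact hp.dvd_of_dvd_pow h
  have hco := r.reduced
  have h1 : 3 ∣ r.num.natAbs := by omega
  have h2 : 3 ∣ r.den := by exact_mod_cast h3d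
  have := Nat.dvd_gcd h1 h2
  rw [hco] at this
  norm_num at this

theorem not_sq_eq_discr (r : ℚ) : r ^ 2 ≠ 1728 / 25 := by
  intro h
  have h3 : IsSquare (3 : ℚ) := ⟨5 * r / 24, by linear_combination -25 / 576 * h⟩
  rw [Rat.isSquare_iff] at h3
  obtain ⟨⟨n, hn⟩, -⟩ := h3
  have hn' : n * n = 3 := by simpa using hn.symm
  have : n < 2 := by nlinarith
  have : -2 < n := by nlinarith
  interval_cases n <;> omega

/-- A Galois extension of `ℚ` over which `X ^ 3 - 3 * X - 6 / 5` splits has a noncommutative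
Galois group. -/
theorem exists_mul_ne_mul_of_cubic_roots {L : Type*} [Field L] [Algebra ℚ L]
    [FiniteDimensional ℚ L] [IsGalois ℚ L]
    {x y z : L} (h₁ : x + y + z = 0) (h₂ : x * y + y * z + z * x = -3)
    (h₃ : x * y * z = 6 / 5) : ∃ σ τ : L ≃ₐ[ℚ] L, σ * τ ≠ τ * σ := by
  have : CharZero L := algebraRat.charZero L
  by_contra! hcomm
  have hroot {t : L} : t ^ 3 - 3 * t - 6 / 5 = 0 ↔ t = x ∨ t = y ∨ t = z := by
    have : t ^ 3 - 3 * t - 6 / 5 = (t - x) * ((t - y) * (t - z)) := by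
      linear_combination t ^ 2 * h₁ - t * h₂ + h₃
    rw [this, mul_eq_zero, mul_eq_zero, sub_eq_zero, sub_eq_zero, sub_eq_zero]
  have hmin {t : L} (ht : t = x ∨ t = y ∨ t = z) :
      minpoly ℚ t = X ^ 3 - C 3 * X - C (6 / 5) := by
    refine (minpoly.eq_of_irreducible_of_monic irreducible_X_pow_three_sub ?_ ?_).symm
    · simpa using hroot.mpr ht
    · monicity!
  have hconj {s t : L} (hs : s = x ∨ s = y ∨ s = z) (ht : t = x ∨ t = y ∨ t = z) :
      IsConjRoot ℚ s t := (hmin hs).trans (hmin ht).symm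
  have hmap (σ : L ≃ₐ[ℚ] L) {t : L} (ht : t = x ∨ t = y ∨ t = z) :
      σ t = x ∨ σ t = y ∨ σ t = z := by
    rw [← hroot] at ht ⊢
    simpa [map_ofNat] using congrArg σ ht
  set δ := (x - y) * (y - z) * (z - x) with hδ
  have hδ2 : δ ^ 2 = 1728 / 25 := by
    obtain rfl : z = -x - y := by linear_combination h₁
    have e₂ : x ^ 2 = 3 - x * y - y ^ 2 := by linear_combination -h₂
    have e₃ : x * y * (x + y) = -6 / 5 := by linear_combination -h₃
    have : δ ^ 2 = 4 * (x ^ 2 + x * y + y ^ 2) ^ 3 - 27 * (x * y * (x + y)) ^ 2 := by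
      rw [hδ]; ring
    rw [this, e₃, e₂]
    ring
  have hδ0 : δ ≠ 0 := by
    intro h
    rw [h] at hδ2
    norm_num at hδ2
  have hxy : x ≠ y := fun h => hδ0 (by rw [hδ, h]; ring)
  have hyz : y ≠ z := fun h => hδ0 (by rw [hδ, h]; ring)
  have hzx : z ≠ x := fun h => hδ0 (by rw [hδ, h]; ring)
  have hfix (σ : L ≃ₐ[ℚ] L) : σ δ = δ := by
    have of_fixed {t : L} (ht : t = x ∨ t = y ∨ t = z) (h : σ t = t) : σ δ = δ := by
      have hall {s : L} (hs : s = x ∨ s = y ∨ s = z) : σ s = s :=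
        apply_eq_of_isConjRoot_of_commute hcomm (hconj ht hs) h
      simp [hδ, hall]
    by_cases hx : σ x = x
    · exact of_fixed (by simp) hx
    by_cases hy : σ y = y
    · exact of_fixed (by simp) hy
    by_cases hz : σ z = z
    · exact of_fixed (by simp) hz
    have i₁ : σ x ≠ σ y := σ.injective.ne hxy
    have i₂ : σ y ≠ σ z := σ.injective.ne hyz
    have i₃ : σ z ≠ σ x := σ.injective.ne hzx
    have hσ : σ δ = (σ x - σ y) * (σ y - σ z) * (σ z - σ x) := by simp [hδ]
    rcases hmap σ (t := x) (by simp) with a | a | a <;>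
      rcases hmap σ (t := y) (by simp) with b | b | b <;>
      rcases hmap σ (t := z) (by simp) with c | c | c <;>
      first
        | (exfalso; simp_all; done)
        | (rw [hσ, a, b, c]; ring)
  obtain ⟨r, hr⟩ := IntermediateField.mem_bot.mp
    ((IsGalois.mem_bot_iff_fixed (F := ℚ) δ).mpr hfix)
  refine not_sq_eq_discr r ((algebraMap ℚ L).injective ?_)
  rw [map_pow, hr, hδ2]
  simp

theorem exists_mul_ne_mul_of_isSplittingField {L : Type*} [Field L] [Algebra ℚ L]
    [hL : IsSplittingField ℚ L (C (5 : ℚ) * X ^ 6 - C 6 * X ^ 3 + C 5)] :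
    ∃ σ τ : L ≃ₐ[ℚ] L, σ * τ ≠ τ * σ := by
  set p : ℚ[X] := C (5 : ℚ) * X ^ 6 - C 6 * X ^ 3 + C 5 with hp
  have : FiniteDimensional ℚ L := IsSplittingField.finiteDimensional L p
  have : Normal ℚ L := Normal.of_isSplittingField p
  have : CharZero L := algebraRat.charZero L
  have : IsGalois ℚ L := ⟨⟩
  have hdeg : p.degree = 6 := by rw [hp]; compute_degree!
  have hp0 : p ≠ 0 := by rintro h; simp [h] at hdeg
  have hs := IsSplittingField.splits L p
  have hmap : p.map (algebraMap ℚ L) = C 5 * X ^ 6 - C 6 * X ^ 3 + C 5 := by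
    simp [hp]
  obtain ⟨u, hu⟩ := hs.exists_eval_eq_zero (by rw [degree_map, hdeg]; norm_num)
  replace hu : 5 * u ^ 6 - 6 * u ^ 3 + 5 = 0 := by simpa [hp] using hu
  have hu0 : u ≠ 0 := by rintro rfl; norm_num at hu
  have hq : (X ^ 2 + C u * X + C (u ^ 2)) ∣ p.map (algebraMap ℚ L) := by
    rw [hmap]
    refine ⟨(X - C u) * (C 5 * X ^ 3 + C (5 * u ^ 3 - 6)), ?_⟩
    have := congrArg (C (R := L)) hu
    simp only [map_add, map_sub, map_mul, map_pow, map_zero] at this ⊢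
    linear_combination this
  have hqs := hs.of_dvd (by simpa [Polynomial.map_eq_zero] using hp0) hq
  obtain ⟨v, hv⟩ := hqs.exists_eval_eq_zero (by
    have : (X ^ 2 + C u * X + C (u ^ 2)).degree = 2 := by compute_degree!
    rw [this]; norm_num)
  replace hv : v ^ 2 + u * v + u ^ 2 = 0 := by simpa using hv
  obtain ⟨w, hw⟩ : ∃ w : L, w ^ 2 + w + 1 = 0 :=
    ⟨v / u, by field_simp; linear_combination hv⟩
  obtain ⟨a, ha⟩ : ∃ a : L, u * a = 1 := ⟨u⁻¹, mul_inv_cancel₀ hu0⟩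
  have hua : u ^ 3 + a ^ 3 = 6 / 5 := by
    obtain rfl : a = u⁻¹ := eq_inv_of_mul_eq_one_right ha
    field_simp
    linear_combination hu
  refine exists_mul_ne_mul_of_cubic_roots (x := u + a) (y := w * u - (1 + w) * a)
    (z := -(1 + w) * u + w * a) (by ring) ?_ ?_
  · linear_combination (-(u ^ 2 + a ^ 2 - 2 * u * a)) * hw - 3 * ha
  · linear_combination hua - (u + a) * (u ^ 2 + a ^ 2 - 2 * u * a) * hw

theorem stmt_2 :
    ∃ σ τ : (C (5 : ℚ) * X ^ 6 - C 6 * X ^ 3 + C 5 : ℚ[X]).Gal,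
      σ * τ ≠ τ * σ := by
  exact @exists_mul_ne_mul_of_isSplittingField _ _ _ (IsSplittingField.splittingField _)
end

section
/- Let $a, b$ be real numbers that are algebraic over $\mathbb{Q}$ with $a \neq 0$, and let $x$ be a nonzero real number satisfying $\sin(x) = ax + b$. Then $x$ is transcendental over $\mathbb{Q}$, and $\sin(x)$ is transcendental over $\mathbb{Q}$. -/
open AddMonoidAlgebra in
/-- An automorphism of `K` acting on both the coefficients and the exponents of the additive
group algebra `K[K]`. -/
noncomputable def galoisTwist {K : Type*} [Field K] [Algebra ℚ K] (σ : K ≃ₐ[ℚ] K) :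
    AddMonoidAlgebra K K →+* AddMonoidAlgebra K K :=
  (mapRingHom K (σ : K →+* K)).comp (mapDomainRingHom K (σ : K →+ K))

section GaloisTwist

open AddMonoidAlgebra

variable {K : Type*} [Field K] [Algebra ℚ K]

theorem galoisTwist_single (σ : K ≃ₐ[ℚ] K) (γ c : K) :
    galoisTwist σ (single γ c) = single (σ γ) (σ c) := by
  simp [galoisTwist]

theorem galoisTwist_galoisTwist (σ τ : K ≃ₐ[ℚ] K) (F : AddMonoidAlgebra K K) :
    galoisTwist σ (galoisTwist τ F) = galoisTwist (σ * τ) F := by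
  induction F using AddMonoidAlgebra.induction_linear with
  | zero => simp
  | add f g hf hg => simp [hf, hg]
  | single a b => simp [galoisTwist_single]

theorem coeff_galoisTwist (σ : K ≃ₐ[ℚ] K) (F : AddMonoidAlgebra K K) (γ : K) :
    (galoisTwist σ F).coeff (σ γ) = σ (F.coeff γ) := by
  classical
  induction F using AddMonoidAlgebra.induction_linear with
  | zero => simp
  | add f g hf hg => simp [hf, hg]
  | single a b =>
    simp [galoisTwist_single, Finsupp.single_apply, apply_ite σ]

theorem exists_galois_invariant_exp_relation [FiniteDimensional ℚ K] [Algebra K ℂ] {α β : K}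
    (hα : α ≠ 0) (h : Complex.exp (algebraMap K ℂ α) = algebraMap K ℂ β) :
    ∃ E : K →₀ K, (∀ (σ : K ≃ₐ[ℚ] K) γ, E (σ γ) = σ (E γ)) ∧
      E.sum (fun γ c ↦ algebraMap K ℂ c * Complex.exp (algebraMap K ℂ γ)) = 0 ∧
      ∃ N : ℕ, N ≠ 0 ∧ E 0 = N := by
  classical
  let e : Multiplicative K →* ℂ :=
    { toFun := fun γ ↦ Complex.exp (algebraMap K ℂ γ.toAdd)
      map_one' := by simp
      map_mul' := fun a b ↦ by simp [Complex.exp_add] }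
  let ev := AddMonoidAlgebra.lift K ℂ K e
  let D : AddMonoidAlgebra K K := single α 1 - single 0 β
  let F : AddMonoidAlgebra K K := ∏ σ : K ≃ₐ[ℚ] K, galoisTwist σ D
  have hF_inv (τ : K ≃ₐ[ℚ] K) : galoisTwist τ F = F := by
    simp only [F, map_prod, galoisTwist_galoisTwist]
    exact Fintype.prod_equiv (Equiv.mulLeft τ) _ _ fun _ ↦ rfl
  have hF_ne : F ≠ 0 := by
    refine Finset.prod_ne_zero_iff.mpr fun σ _ h0 ↦ ?_
    have := congrArg (fun x ↦ x.coeff (σ α)) h0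
    simp [coeff_galoisTwist, D, hα.symm] at this
  have hF_ev : ev F = 0 := by
    rw [map_prod]
    refine Finset.prod_eq_zero (Finset.mem_univ 1) ?_
    simp [D, galoisTwist_single, ev, e, h, Algebra.smul_def]
  obtain ⟨γ, hγ⟩ : ∃ γ, F.coeff γ ≠ 0 := by
    by_contra! h0
    exact hF_ne (by ext γ; simpa using h0 γ)
  let H : AddMonoidAlgebra K K :=
    ∑ τ : K ≃ₐ[ℚ] K, galoisTwist τ (single (-γ) (F.coeff γ)⁻¹)
  have hH_inv (τ : K ≃ₐ[ℚ] K) : galoisTwist τ H = H := by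
    simp only [H, map_sum, galoisTwist_galoisTwist]
    exact Fintype.sum_equiv (Equiv.mulLeft τ) _ _ fun _ ↦ rfl
  have hF_coeff (τ : K ≃ₐ[ℚ] K) : F.coeff (τ γ) = τ (F.coeff γ) := by
    conv_lhs => rw [← hF_inv τ, coeff_galoisTwist]
  refine ⟨(F * H).coeff, fun σ δ ↦ ?_, ?_, Fintype.card (K ≃ₐ[ℚ] K), Fintype.card_ne_zero, ?_⟩
  · rw [← coeff_galoisTwist, map_mul, hF_inv, hH_inv]
  · have : ev (F * H) = 0 := by rw [map_mul, hF_ev, zero_mul]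
    rw [AddMonoidAlgebra.lift_apply] at this
    simpa [e, Algebra.smul_def] using this
  · simp [H, Finset.mul_sum, galoisTwist_single, hF_coeff, hγ]

end GaloisTwist

section HermiteLindemann

open Polynomial

open scoped Nat

theorem Polynomial.isIntegral_pow_mul_aeval {K : Type*} [Field K] {d : ℤ} {γ : K}
    (hγ : IsIntegral ℤ (d * γ)) {g : ℤ[X]} {m : ℕ} (hg : g.natDegree ≤ m) :
    IsIntegral ℤ ((d : K) ^ m * aeval γ g) := by
  rw [aeval_eq_sum_range' (Nat.lt_succ_of_le hg), Finset.mul_sum]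
  refine IsIntegral.sum _ fun i hi ↦ ?_
  have hi' : i ≤ m := Nat.le_of_lt_succ (Finset.mem_range.mp hi)
  have : (d : K) ^ m * g.coeff i • γ ^ i =
      ((g.coeff i * d ^ (m - i) : ℤ) : K) * ((d : K) * γ) ^ i := by
    rw [← Nat.sub_add_cancel hi', pow_add, Nat.sub_add_cancel hi', zsmul_eq_mul]
    push_cast
    ring
  rw [this]
  exact (isIntegral_algebraMap (R := ℤ) (A := K)).mul (hγ.pow i)

variable {K : Type*} [Field K] [Algebra ℚ K]

theorem exists_polynomial_vanishing_on_finset [FiniteDimensional ℚ K] (S : Finset K)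
    (hS : ∀ γ ∈ S, γ ≠ 0) :
    ∃ f : ℤ[X], f.eval 0 ≠ 0 ∧ ∀ γ ∈ S, aeval γ f = 0 := by
  have h (γ : S) : ∃ q : ℤ[X], q.coeff 0 ≠ 0 ∧ aeval (γ : K) q = 0 := by
    have : IsAlgebraic ℤ (γ : K) :=
      (IsFractionRing.isAlgebraic_iff ℤ ℚ K).mpr (Algebra.IsAlgebraic.isAlgebraic _)
    exact this.exists_nonzero_coeff_and_aeval_eq_zero (mem_nonZeroDivisors_of_ne_zero (hS γ γ.2))
  choose q hq0 hq using h
  refine ⟨∏ γ : S, q γ, ?_, fun γ hγ ↦ ?_⟩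
  · rw [eval_prod]
    exact Finset.prod_ne_zero_iff.mpr fun γ _ ↦ by simpa [coeff_zero_eq_eval_zero] using hq0 γ
  · rw [map_prod]
    exact Finset.prod_eq_zero (Finset.mem_univ ⟨γ, hγ⟩) (hq ⟨γ, hγ⟩)

theorem exists_int_eq_pow_mul_sum_aeval [FiniteDimensional ℚ K] [IsGalois ℚ K] [DecidableEq K]
    {E : K →₀ K} (hE : ∀ (σ : K ≃ₐ[ℚ] K) γ, E (σ γ) = σ (E γ)) {d : ℤ}
    (hd : ∀ γ ∈ E.support, IsIntegral ℤ (d * γ) ∧ IsIntegral ℤ (d * E γ))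
    {g : ℤ[X]} {m : ℕ} (hg : g.natDegree ≤ m) :
    ∃ z : ℤ, (d : K) ^ (m + 1) * ∑ γ ∈ E.support.erase 0, E γ * aeval γ g = z := by
  have h_fixed (σ : K ≃ₐ[ℚ] K) : σ (∑ γ ∈ E.support.erase 0, E γ * aeval γ g) =
      ∑ γ ∈ E.support.erase 0, E γ * aeval γ g := by
    rw [map_sum]
    refine Finset.sum_equiv σ.toEquiv (fun γ ↦ ?_) fun γ _ ↦ ?_
    · simp [hE]
    · have : aeval (σ γ) g = σ (aeval γ g) :=
        aeval_algHom_apply ((σ : K →+* K).toIntAlgHom) γ g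
      simp [hE, this]
  obtain ⟨q, hq⟩ := (IsGalois.mem_range_algebraMap_iff_fixed _).mpr h_fixed
  have h_int : IsIntegral ℤ
      ((d : K) ^ (m + 1) * ∑ γ ∈ E.support.erase 0, E γ * aeval γ g) := by
    rw [Finset.mul_sum]
    refine IsIntegral.sum _ fun γ hγ ↦ ?_
    obtain ⟨h1, h2⟩ := hd γ (Finset.mem_of_mem_erase hγ)
    rw [show (d : K) ^ (m + 1) * (E γ * aeval γ g) = (d * E γ) * (d ^ m * aeval γ g) by ring]
    exact h2.mul (isIntegral_pow_mul_aeval h1 hg)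
  rw [← hq] at h_int ⊢
  have h_eq : (d : K) ^ (m + 1) * algebraMap ℚ K q = algebraMap ℚ K (d ^ (m + 1) * q) := by
    rw [map_mul, map_pow, map_intCast]
  rw [h_eq] at h_int ⊢
  rw [isIntegral_algebraMap_iff (algebraMap ℚ K).injective] at h_int
  obtain ⟨z, hz⟩ := IsIntegrallyClosed.isIntegral_iff.mp h_int
  exact ⟨z, by rw [← hz]; simp⟩

theorem galois_invariant_exp_sum_ne_zero [FiniteDimensional ℚ K] [IsGalois ℚ K] [Algebra K ℂ]
    {E : K →₀ K} (hE : ∀ (σ : K ≃ₐ[ℚ] K) γ, E (σ γ) = σ (E γ)) {N : ℕ} (hN : N ≠ 0)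
    (hE0 : E 0 = N) :
    E.sum (fun γ c ↦ algebraMap K ℂ c * Complex.exp (algebraMap K ℂ γ)) ≠ 0 := by
  classical
  intro h_sum
  have : CharZero K := algebraRat.charZero K
  set S := E.support.erase 0
  obtain ⟨d, hd0, hd⟩ : ∃ d : ℤ, d ≠ 0 ∧
      ∀ γ ∈ E.support, IsIntegral ℤ (d * γ) ∧ IsIntegral ℤ (d * E γ) := by
    have : Algebra.IsAlgebraic ℤ K :=
      (IsFractionRing.comap_isAlgebraic_iff (A := ℤ) (K := ℚ) (C := K)).mpr inferInstance
    obtain ⟨d, hd0, hd⟩ := Algebra.IsAlgebraic.exists_integral_multiples ℤ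
      (E.support ∪ E.support.image E)
    simp only [zsmul_eq_mul] at hd
    exact ⟨d, hd0, fun γ hγ ↦ ⟨hd γ (Finset.mem_union_left _ hγ),
      hd _ (Finset.mem_union_right _ (Finset.mem_image_of_mem _ hγ))⟩⟩
  obtain ⟨f, hf0, hf⟩ := exists_polynomial_vanishing_on_finset S
    fun γ hγ ↦ Finset.ne_of_mem_erase hγ
  obtain ⟨c, hc⟩ := LindemannWeierstrass.exp_polynomial_approx f hf0
  set m := f.natDegree
  set C : ℝ := ∑ γ ∈ S, ‖algebraMap K ℂ (E γ)‖
  have h_small := (FloorSemiring.tendsto_mul_pow_div_factorial_sub_atTop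
    (|(d : ℝ)| * C) (|(d : ℝ)| ^ m * c) 1).eventually_lt_const one_pos
  obtain ⟨p₀, hp₀⟩ := Filter.eventually_atTop.mp h_small
  obtain ⟨p, hp_ge, hp⟩ :=
    Nat.exists_infinite_primes (p₀ + (f.eval 0).natAbs + d.natAbs + N + 1)
  obtain ⟨n, hpn, g, hg_deg, hg⟩ := hc p (by lia) hp
  obtain ⟨z, hz⟩ := exists_int_eq_pow_mul_sum_aeval hE hd
    (show g.natDegree ≤ p * m by lia)
  set w : ℤ := d ^ (p * m + 1) * N * n + p * z
  have hw_ne : w ≠ 0 := by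
    intro hw
    have h_dvd : (p : ℤ) ∣ d ^ (p * m + 1) * N * n :=
      ⟨-z, by linear_combination hw⟩
    have hp' := Nat.prime_iff_prime_int.mp hp
    rcases hp'.dvd_or_dvd h_dvd with h | h
    · rcases hp'.dvd_or_dvd h with h | h
      · have := Int.natAbs_dvd_natAbs.mpr (hp'.dvd_of_dvd_pow h)
        have := Nat.le_of_dvd (Int.natAbs_pos.mpr hd0) this
        simp at this
        lia
      · have := Nat.le_of_dvd (Nat.pos_of_ne_zero hN) (Int.natCast_dvd_natCast.mp h)
        lia
    · exact hpn h
  have h_rel : (N : ℂ) +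
      ∑ γ ∈ S, algebraMap K ℂ (E γ) * Complex.exp (algebraMap K ℂ γ) = 0 := by
    rw [Finsupp.sum, ← Finset.add_sum_erase _ _ (show (0 : K) ∈ E.support by simp [hE0, hN])]
      at h_sum
    simpa [hE0] using h_sum
  have hz' : (d : ℂ) ^ (p * m + 1) *
      ∑ γ ∈ S, algebraMap K ℂ (E γ) * aeval (algebraMap K ℂ γ) g = z := by
    have := congrArg (algebraMap K ℂ) hz
    simpa [aeval_algebraMap_apply] using this
  have hw_eq : (w : ℂ) = -((d : ℂ) ^ (p * m + 1) * ∑ γ ∈ S, algebraMap K ℂ (E γ) *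
      (n • Complex.exp (algebraMap K ℂ γ) - p • aeval (algebraMap K ℂ γ) g)) := by
    simp only [nsmul_eq_mul, zsmul_eq_mul, mul_sub, Finset.sum_sub_distrib,
      mul_left_comm _ (n : ℂ), mul_left_comm _ (p : ℂ), ← Finset.mul_sum]
    push_cast [w]
    linear_combination (d : ℂ) ^ (p * m + 1) * n * h_rel - p * hz'
  have h_norm : ‖(w : ℂ)‖ ≤ |(d : ℝ)| * C * (|(d : ℝ)| ^ m * c) ^ p / (p - 1)! := by
    rw [hw_eq, norm_neg, norm_mul, norm_pow, Complex.norm_intCast]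
    calc _ ≤ |(d : ℝ)| ^ (p * m + 1) * (C * (c ^ p / (p - 1)!)) := by
          gcongr
          rw [Finset.sum_mul]
          refine norm_sum_le_of_le _ fun γ hγ ↦ ?_
          rw [norm_mul]
          gcongr
          refine hg (mem_aroots.mpr ⟨?_, ?_⟩)
          · rintro rfl
            simp at hf0
          · rw [aeval_algebraMap_apply, hf γ hγ, map_zero]
      _ = _ := by ring
  have h_one : (1 : ℝ) ≤ ‖(w : ℂ)‖ := by
    rw [Complex.norm_intCast]
    exact_mod_cast Int.one_le_abs hw_ne
  exact absurd (hp₀ p (by lia)) (not_lt.mpr (h_one.trans h_norm))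

/-- The **Hermite-Lindemann theorem**. -/
theorem transcendental_cexp {α : ℂ} (hα : IsAlgebraic ℚ α) (hα0 : α ≠ 0) :
    Transcendental ℚ (Complex.exp α) := by
  intro hβ
  let p : ℚ[X] := minpoly ℚ α * minpoly ℚ (Complex.exp α)
  have hp : p ≠ 0 := mul_ne_zero (minpoly.ne_zero hα.isIntegral) (minpoly.ne_zero hβ.isIntegral)
  let K := IntermediateField.adjoin ℚ (p.rootSet ℂ)
  have : p.IsSplittingField ℚ K :=
    IntermediateField.adjoin_rootSet_isSplittingField (IsAlgClosed.splits _)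
  have : FiniteDimensional ℚ K := IsSplittingField.finiteDimensional K p
  have : Normal ℚ K := Normal.of_isSplittingField p
  have : IsGalois ℚ K := ⟨⟩
  let a : K := ⟨α, IntermediateField.subset_adjoin _ _ (mem_rootSet.mpr ⟨hp, by simp [p]⟩)⟩
  let b : K := ⟨Complex.exp α,
    IntermediateField.subset_adjoin _ _ (mem_rootSet.mpr ⟨hp, by simp [p]⟩)⟩
  obtain ⟨E, hE, h_sum, N, hN, hE0⟩ := exists_galois_invariant_exp_relation (α := a) (β := b)
    (fun h ↦ hα0 (congrArg Subtype.val h)) rfl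
  exact galois_invariant_exp_sum_ne_zero hE hN hE0 h_sum

theorem transcendental_sin {x : ℝ} (hx : IsAlgebraic ℚ x) (hx0 : x ≠ 0) :
    Transcendental ℚ (Real.sin x) := by
  intro hs
  have hc : IsAlgebraic ℚ (Real.cos x) := by
    refine IsAlgebraic.of_pow two_pos ?_
    rw [Real.cos_sq']
    exact isAlgebraic_one.sub (hs.pow 2)
  have hI : IsAlgebraic ℚ Complex.I :=
    IsAlgebraic.of_pow two_pos (by rw [Complex.I_sq]; exact isAlgebraic_one.neg)
  have toComplex {y : ℝ} (hy : IsAlgebraic ℚ y) : IsAlgebraic ℚ (y : ℂ) := hy.algebraMap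
  refine transcendental_cexp ((toComplex hx).mul hI) (by simp [hx0]) ?_
  rw [Complex.exp_mul_I, ← Complex.ofReal_cos, ← Complex.ofReal_sin]
  exact (toComplex hc).add ((toComplex hs).mul hI)

end HermiteLindemann

theorem stmt_10 (a b x : ℝ) (ha : IsAlgebraic ℚ a) (hb : IsAlgebraic ℚ b)
    (ha0 : a ≠ 0) (hx0 : x ≠ 0) (hx : Real.sin x = a * x + b) :
    Transcendental ℚ x ∧ Transcendental ℚ (Real.sin x) := by
  have h_not_alg : Transcendental ℚ x := fun h ↦
    transcendental_sin h hx0 (by rw [hx]; exact (ha.mul h).add hb)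
  refine ⟨h_not_alg, fun hs ↦ h_not_alg ?_⟩
  have : x = (Real.sin x - b) * a⁻¹ := by
    rw [hx]
    field_simp
    ring
  rw [this]
  exact (hs.sub hb).mul ha.inv
end

section
/- Let $a, b$ be real numbers that are algebraic over $\mathbb{Q}$ with $a \neq 0$, and let $x$ be a nonzero real number satisfying $\sin(x) = ax + b$. Then $x$ is not a rational multiple of $\pi$: for every rational number $r$, $x \neq r\pi$. -/
open Polynomial in
/-- Clearing denominators in a polynomial expression of bounded degree. -/
theorem isIntegral_pow_mul_aeval {A : Type*} [CommRing A] {z : A} {d : ℤ}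
    (hz : IsIntegral ℤ (d * z)) (g : ℤ[X]) {N : ℕ} (hN : g.natDegree ≤ N) :
    IsIntegral ℤ ((d : A) ^ N * aeval z g) := by
  rw [aeval_eq_sum_range, Finset.mul_sum]
  refine IsIntegral.sum _ fun i hi => ?_
  have hiN : i ≤ N := (Nat.lt_succ_iff.mp (Finset.mem_range.mp hi)).trans hN
  have : (d : A) ^ N * (g.coeff i • z ^ i) =
      ((g.coeff i * d ^ (N - i) : ℤ) : A) * (d * z) ^ i := by
    rw [← Nat.sub_add_cancel hiN, pow_add, zsmul_eq_mul]
    push_cast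
    rw [Nat.add_sub_cancel, mul_pow]
    ring
  rw [this]
  exact (isIntegral_algebraMap (R := ℤ) (A := A)).mul (hz.pow i)

/-- Finitely many algebraic numbers have a common denominator. -/
theorem exists_int_forall_isIntegral_mul {ι : Type*} [Fintype ι] {α : ι → ℂ}
    (hα : ∀ i, IsAlgebraic ℤ (α i)) :
    ∃ d : ℤ, d ≠ 0 ∧ ∀ i, IsIntegral ℤ (d * α i) := by
  classical
  choose d hd hint using fun i => (hα i).exists_integral_multiple
  refine ⟨∏ i, d i, Finset.prod_ne_zero_iff.mpr fun i _ => hd i, fun i => ?_⟩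
  rw [← Finset.prod_erase_mul _ _ (Finset.mem_univ i)]
  push_cast
  have := (isIntegral_algebraMap (R := ℤ) (A := ℂ)
    (x := ∏ j ∈ Finset.univ.erase i, d j)).mul (hint i)
  simpa [mul_assoc] using this

open Polynomial in
/-- Finitely many nonzero algebraic numbers are roots of an integer polynomial with nonzero
constant coefficient. -/
theorem exists_eval_zero_ne_zero_forall_mem_aroots {ι : Type*} [Fintype ι] {α : ι → ℂ}
    (hα : ∀ i, IsAlgebraic ℤ (α i)) (hα0 : ∀ i, α i ≠ 0) :
    ∃ f : ℤ[X], f.eval 0 ≠ 0 ∧ ∀ i, α i ∈ f.aroots ℂ := by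
  choose f hf0 hf using fun i =>
    (hα i).exists_nonzero_coeff_and_aeval_eq_zero (mem_nonZeroDivisors_of_ne_zero (hα0 i))
  have h0 : (∏ i, f i).eval 0 ≠ 0 := by
    rw [eval_prod]
    exact Finset.prod_ne_zero_iff.mpr fun i _ => by
      rw [← coeff_zero_eq_eval_zero]; exact hf0 i
  refine ⟨_, h0, fun i => ?_⟩
  rw [mem_aroots]
  refine ⟨fun h => h0 (by rw [h, eval_zero]), ?_⟩
  rw [map_prod]
  exact Finset.prod_eq_zero (Finset.mem_univ i) (hf i)

open Polynomial in
/-- A case of the Lindemann-Weierstrass theorem: if for nonzero algebraic numbers `α i` all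
sums `∑ i, g (α i)` with `g` an integer polynomial are rational, then `∑ i, exp (α i)` is not a
nonzero integer. -/
theorem intCast_add_sum_exp_ne_zero {ι : Type*} [Fintype ι] {α : ι → ℂ}
    (hα : ∀ i, IsAlgebraic ℤ (α i)) (hα0 : ∀ i, α i ≠ 0)
    (hsum : ∀ g : ℤ[X], ∃ q : ℚ, ∑ i, aeval (α i) g = q) {k : ℤ} (hk : k ≠ 0) :
    (k : ℂ) + ∑ i, Complex.exp (α i) ≠ 0 := by
  intro hzero
  obtain ⟨d, hd, hint⟩ := exists_int_forall_isIntegral_mul hα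
  obtain ⟨f, hf0, hf⟩ := exists_eval_zero_ne_zero_forall_mem_aroots hα hα0
  obtain ⟨c, hc⟩ := LindemannWeierstrass.exp_polynomial_approx f hf0
  set x : ℝ := |(d : ℝ)| ^ f.natDegree * c with hx
  have hlim : Filter.Tendsto
      (fun p : ℕ => Fintype.card ι * x * (x ^ (p - 1) / ((p - 1).factorial : ℝ)))
      Filter.atTop (nhds 0) := by
    simpa using ((FloorSemiring.tendsto_pow_div_factorial_atTop x).comp
      (Filter.tendsto_sub_atTop_nat 1)).const_mul (Fintype.card ι * x)
  obtain ⟨M, hM⟩ := Filter.eventually_atTop.mp (hlim.eventually (gt_mem_nhds one_pos))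
  obtain ⟨p, hpM, hp⟩ := Nat.exists_infinite_primes
    (M + (f.eval 0).natAbs + k.natAbs + d.natAbs + 1)
  obtain ⟨n, hpn, g, hdeg, hg⟩ := hc p (by omega) hp
  set N := p * f.natDegree with hN
  obtain ⟨m, hm⟩ : ∃ m : ℤ, (d : ℂ) ^ N * ∑ i, aeval (α i) g = m := by
    refine (IsIntegral.exists_int_iff_exists_rat ?_).mp ?_
    · rw [Finset.mul_sum]
      exact IsIntegral.sum _ fun i _ => isIntegral_pow_mul_aeval (hint i) g (by omega)
    · obtain ⟨q, hq⟩ := hsum g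
      exact ⟨d ^ N * q, by rw [hq]; push_cast; rfl⟩
  have hkey : ((d ^ N * (k * n) + p * m : ℤ) : ℂ) =
      -(d ^ N * ∑ i, (n • Complex.exp (α i) - p • aeval (α i) g)) := by
    simp only [Finset.sum_sub_distrib, zsmul_eq_mul, nsmul_eq_mul, ← Finset.mul_sum]
    push_cast
    rw [← hm, eq_neg_of_add_eq_zero_left hzero]
    ring
  have hlt : ‖((d ^ N * (k * n) + p * m : ℤ) : ℂ)‖ < 1 := by
    rw [hkey, norm_neg, norm_mul, norm_pow, Complex.norm_intCast]
    calc |(d : ℝ)| ^ N * ‖∑ i, (n • Complex.exp (α i) - p • aeval (α i) g)‖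
        ≤ |(d : ℝ)| ^ N * (Fintype.card ι * (c ^ p / ((p - 1).factorial : ℝ))) := by
          gcongr
          refine (norm_sum_le_of_le _ fun i _ => hg (hf i)).trans_eq ?_
          simp
      _ = Fintype.card ι * x * (x ^ (p - 1) / ((p - 1).factorial : ℝ)) := by
          have : x * x ^ (p - 1) = |(d : ℝ)| ^ N * c ^ p := by
            rw [← pow_succ', Nat.sub_add_cancel hp.one_le, hx, mul_pow, ← pow_mul, hN, mul_comm p]
          rw [mul_assoc (Fintype.card ι : ℝ) x, ← mul_div_assoc x, this]
          ring
      _ < 1 := hM p (by omega)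
  rw [Complex.norm_intCast, ← Int.cast_abs, ← Int.cast_one, Int.cast_lt, Int.abs_lt_one_iff] at hlt
  have hpZ : Prime (p : ℤ) := Nat.prime_iff_prime_int.mp hp
  have hdvd : (p : ℤ) ∣ d ^ N * (k * n) := by
    rw [← dvd_add_left (dvd_mul_right (p : ℤ) m), hlt]
    exact dvd_zero _
  have hnot {z : ℤ} (hz : z ≠ 0) (hzp : z.natAbs < p) : ¬ (p : ℤ) ∣ z := fun h =>
    absurd (Nat.le_of_dvd (Int.natAbs_pos.mpr hz) (Int.natCast_dvd.mp h)) (not_le.mpr hzp)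
  rcases hpZ.dvd_or_dvd hdvd with h | h
  · exact hnot hd (by omega) (hpZ.dvd_of_dvd_pow h)
  · rcases hpZ.dvd_or_dvd h with h | h
    · exact hnot hk (by omega) h
    · exact hpn h

open Finset Pointwise in
/-- An element of a Galois number field embedded in `ℂ` never has exponential `-1`. -/
theorem exp_ne_neg_one_of_isGalois {K : Type*} [Field K] [NumberField K] [IsGalois ℚ K]
    (φ : K →+* ℂ) (t : K) : Complex.exp (φ t) ≠ -1 := by
  classical
  intro ht
  set α : Finset (K ≃ₐ[ℚ] K) → K := fun S => ∑ σ ∈ S, σ t with hα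
  have hsmul (τ : K ≃ₐ[ℚ] K) (S : Finset (K ≃ₐ[ℚ] K)) : α (τ • S) = τ (α S) := by
    simp only [hα, map_sum]
    rw [smul_finset_def, sum_image fun _ _ _ _ h => smul_left_cancel τ h]
    rfl
  have hprod : ∑ S, Complex.exp (φ (α S)) = 0 := by
    have h : ∏ σ : K ≃ₐ[ℚ] K, (1 + Complex.exp (φ (σ t))) = 0 :=
      prod_eq_zero (mem_univ 1) (by simp [ht])
    rw [prod_one_add] at h
    simpa [hα, map_sum, Complex.exp_sum] using h
  set k : ℤ := ((#{S | α S = 0} : ℕ) : ℤ) with hkdef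
  have hk : k ≠ 0 := by
    rw [hkdef, Nat.cast_ne_zero, card_ne_zero]
    exact ⟨∅, by simp [hα]⟩
  refine intCast_add_sum_exp_ne_zero (ι := {S // α S ≠ 0}) (α := fun S => φ (α S))
    (fun S => ?_) (fun S => by simpa using S.2) (fun g => ?_) hk ?_
  · have h : IsAlgebraic ℤ (α S) :=
      (IsFractionRing.isAlgebraic_iff ℤ ℚ K).mpr (Algebra.IsAlgebraic.isAlgebraic _)
    exact h.algHom φ.toIntAlgHom
  · have hfix (τ : K ≃ₐ[ℚ] K) : τ (∑ S : {S // α S ≠ 0}, Polynomial.aeval (α S) g) =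
        ∑ S : {S // α S ≠ 0}, Polynomial.aeval (α S) g := by
      rw [map_sum]
      refine Fintype.sum_equiv ((MulAction.toPerm τ).subtypeEquiv fun S => ?_) _ _ fun S => ?_
      · simp [hsmul]
      · simp only [Equiv.subtypeEquiv_apply, MulAction.toPerm_apply, hsmul]
        exact (Polynomial.aeval_algHom_apply (τ.toAlgHom.restrictScalars ℤ) (α S) g).symm
    obtain ⟨q, hq⟩ := (IsGalois.mem_range_algebraMap_iff_fixed _).mpr hfix
    refine ⟨q, ?_⟩
    have := congrArg φ hq
    rw [map_sum] at this
    simp only [eq_ratCast, map_ratCast] at this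
    rw [this]
    exact sum_congr rfl fun S _ => Polynomial.aeval_algHom_apply φ.toIntAlgHom (α S) g
  · rw [← hprod, ← Fintype.sum_subtype_add_sum_subtype (fun S => α S = 0)]
    congr 1
    rw [hkdef, ← Fintype.card_subtype,
      sum_congr rfl fun S _ => by rw [S.2, map_zero, Complex.exp_zero]]
    simp

open Polynomial in
/-- **Lindemann's theorem**: `π` is transcendental. -/
theorem transcendental_pi : Transcendental ℚ Real.pi := by
  intro hpi
  have hθ : IsAlgebraic ℚ (Real.pi * Complex.I) :=
    (hpi.algebraMap (A := ℂ)).mul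
      ((IsFractionRing.isAlgebraic_iff ℤ ℚ ℂ).mp Complex.isIntegral_int_I.isAlgebraic)
  set p := minpoly ℚ (Real.pi * Complex.I) with hp
  have hp0 : p ≠ 0 := minpoly.ne_zero hθ.isIntegral
  let K := IntermediateField.adjoin ℚ (p.rootSet ℂ)
  have hsplit : p.IsSplittingField ℚ K :=
    IntermediateField.adjoin_rootSet_isSplittingField (IsAlgClosed.splits _)
  have : FiniteDimensional ℚ K := IsSplittingField.finiteDimensional K p
  have : NumberField K := {}
  have : IsGalois ℚ K :=
    IsGalois.of_separable_splitting_field (minpoly.irreducible hθ.isIntegral).separable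
  have hmem : Real.pi * Complex.I ∈ K :=
    IntermediateField.subset_adjoin ℚ _ (mem_rootSet.mpr ⟨hp0, minpoly.aeval _ _⟩)
  exact exp_ne_neg_one_of_isGalois (algebraMap K ℂ) ⟨_, hmem⟩ Complex.exp_pi_mul_I

theorem stmt_11 (a b x : ℝ) (ha : IsAlgebraic ℚ a) (hb : IsAlgebraic ℚ b)
    (ha0 : a ≠ 0) (hx0 : x ≠ 0) (hx : Real.sin x = a * x + b) :
    ∀ r : ℚ, x ≠ r * Real.pi := by
  rintro r rfl
  have hr : (r : ℝ) ≠ 0 := left_ne_zero_of_mul hx0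
  have hsin : IsAlgebraic ℚ (Real.sin (r * Real.pi)) :=
    (IsFractionRing.isAlgebraic_iff ℤ ℚ ℝ).mp (Real.isAlgebraic_sin_rat_mul_pi r)
  have hpi : Real.pi = (Real.sin (r * Real.pi) - b) * (a * r)⁻¹ := by
    rw [hx]
    field_simp
    ring
  refine transcendental_pi ?_
  rw [hpi]
  exact (hsin.sub hb).mul (ha.mul (isAlgebraic_algebraMap r)).inv
end

section
/- The family of complex numbers $\left(e^{i\sqrt{p}}\right)_{p \text{ prime}}$, indexed by the prime natural numbers $p$, is algebraically independent over $\mathbb{Q}$. -/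
namespace LindemannWeierstrass

open Polynomial Filter
open scoped Nat

/-- Ring homomorphisms commute with evaluation of integer polynomials. -/
theorem map_aeval_int {R S : Type*} [CommRing R] [CommRing S] (ι : R →+* S) (x : R) (g : ℤ[X]) :
    ι (aeval x g) = aeval (ι x) g :=
  (aeval_algHom_apply ι.toIntAlgHom x g).symm

/-- If `x` is a root of `f : ℤ[X]` with leading coefficient `l`, then `l ^ N * g(x)` is integral for
every `g : ℤ[X]` of degree at most `N`. -/
theorem isIntegral_pow_mul_aeval {K : Type*} [Field K] (f g : ℤ[X]) {x : K} (hx : aeval x f = 0)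
    {N : ℕ} (hN : g.natDegree ≤ N) :
    IsIntegral ℤ ((f.leadingCoeff : K) ^ N * aeval x g) := by
  have hl : IsIntegral ℤ ((f.leadingCoeff : K) * x) := by
    simpa using isIntegral_leadingCoeff_smul f x hx
  rw [aeval_eq_sum_range' (Nat.lt_succ_of_le hN), Finset.mul_sum]
  refine IsIntegral.sum _ fun i hi => ?_
  have hi' : i ≤ N := Nat.lt_succ_iff.mp (Finset.mem_range.mp hi)
  have : (f.leadingCoeff : K) ^ N * (g.coeff i • x ^ i) =
      ((g.coeff i * f.leadingCoeff ^ (N - i) : ℤ) : K) * ((f.leadingCoeff : K) * x) ^ i := by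
    rw [← pow_sub_mul_pow _ hi', zsmul_eq_mul]
    push_cast
    ring
  rw [this]
  exact (isIntegral_algebraMap (R := ℤ) (A := K)).mul (hl.pow i)

/-- Finitely many nonzero algebraic numbers are roots of a common integer polynomial with nonzero
constant term. -/
theorem exists_int_polynomial_forall_root {K : Type*} [Field K] [CharZero K]
    [Algebra.IsAlgebraic ℤ K] (s : Finset K) (hs : (0 : K) ∉ s) :
    ∃ f : ℤ[X], f.eval 0 ≠ 0 ∧ ∀ x ∈ s, aeval x f = 0 := by
  have h (x : K) (hx : x ≠ 0) : ∃ q : ℤ[X], q.eval 0 ≠ 0 ∧ aeval x q = 0 := by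
    obtain ⟨q, hq0, hq⟩ := (Algebra.IsAlgebraic.isAlgebraic (R := ℤ) x)
      |>.exists_nonzero_coeff_and_aeval_eq_zero (mem_nonZeroDivisors_of_ne_zero hx)
    exact ⟨q, by rwa [← coeff_zero_eq_eval_zero], hq⟩
  choose! q hq0 hq using h
  refine ⟨∏ x ∈ s, q x, ?_, fun x hx => ?_⟩
  · rw [eval_prod]
    exact Finset.prod_ne_zero_iff.mpr fun x hx => hq0 x (ne_of_mem_of_not_mem hx hs)
  · rw [map_prod]
    exact Finset.prod_eq_zero hx (hq x (ne_of_mem_of_not_mem hx hs))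

/-- There are arbitrarily large primes `p` for which `a * c ^ p / (p - 1)!` is less than one. -/
theorem exists_prime_mul_pow_div_factorial_lt_one (m : ℕ) (a c : ℝ) :
    ∃ p : ℕ, p.Prime ∧ m < p ∧ a * (c ^ p / (p - 1)!) < 1 := by
  have h : Tendsto (fun n : ℕ => a * c * (c ^ n / n !)) atTop (nhds 0) := by
    simpa using (FloorSemiring.tendsto_pow_div_factorial_atTop c).const_mul (a * c)
  obtain ⟨n, hn⟩ := eventually_atTop.mp (h.eventually_lt_const one_pos)
  obtain ⟨p, hp, hpp⟩ := Nat.exists_infinite_primes (m + n + 1)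
  refine ⟨p, hpp, by omega, ?_⟩
  have hlt := hn (p - 1) (by omega)
  rwa [mul_assoc, ← mul_div_assoc, mul_pow_sub_one hpp.ne_zero] at hlt

/-- A Galois-stable sum of algebraic integers is a rational integer. -/
theorem exists_int_cast_eq_sum_of_invariant {K : Type*} [Field K] [Algebra ℚ K]
    [FiniteDimensional ℚ K] [IsGalois ℚ K] (s : Finset K) (h : K → K)
    (hs : ∀ (σ : K ≃ₐ[ℚ] K) (x : K), x ∈ s → σ x ∈ s)
    (hh : ∀ (σ : K ≃ₐ[ℚ] K) (x : K), x ∈ s → h (σ x) = σ (h x))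
    (hint : ∀ x ∈ s, IsIntegral ℤ (h x)) : ∃ m : ℤ, (m : K) = ∑ x ∈ s, h x := by
  have hfix : ∀ σ : K ≃ₐ[ℚ] K, σ (∑ x ∈ s, h x) = ∑ x ∈ s, h x := fun σ => by
    rw [map_sum]
    refine Finset.sum_bij' (fun x _ => σ x) (fun x _ => σ.symm x) (hs σ) (hs σ.symm)
      (by simp) (by simp) (fun x hx => (hh σ x hx).symm)
  obtain ⟨q, hq⟩ := (IsGalois.mem_range_algebraMap_iff_fixed _).mpr hfix
  have hqi : IsIntegral ℤ q := by
    rw [← isIntegral_algebraMap_iff (algebraMap ℚ K).injective, hq]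
    exact IsIntegral.sum _ hint
  obtain ⟨m, hm⟩ := IsIntegrallyClosed.isIntegral_iff.mp hqi
  exact ⟨m, by rw [← hq, ← hm]; simp⟩

/-- A vanishing Galois-invariant integral combination of exponentials of algebraic numbers has zero
constant term. -/
theorem eq_zero_of_sum_exp_eq_zero_of_invariant {K : Type*} [Field K] [Algebra ℚ K]
    [FiniteDimensional ℚ K] [IsGalois ℚ K] (ι : K →+* ℂ) (s : Finset K) (hs0 : (0 : K) ∉ s)
    (w : K → ℤ) (hs : ∀ (σ : K ≃ₐ[ℚ] K) (x : K), x ∈ s → σ x ∈ s)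
    (hw : ∀ (σ : K ≃ₐ[ℚ] K) (x : K), w (σ x) = w x) (b : ℤ)
    (h : (b : ℂ) + ∑ x ∈ s, w x * Complex.exp (ι x) = 0) : b = 0 := by
  have : CharZero K := algebraRat.charZero K
  have : Algebra.IsAlgebraic ℤ K :=
    (IsFractionRing.comap_isAlgebraic_iff (A := ℤ) (K := ℚ)).mpr inferInstance
  by_contra hb
  obtain ⟨f, hf0, hf⟩ := exists_int_polynomial_forall_root s hs0
  have hfne : f ≠ 0 := by rintro rfl; simp at hf0
  have hl0 : f.leadingCoeff ≠ 0 := leadingCoeff_ne_zero.mpr hfne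
  set l := f.leadingCoeff
  obtain ⟨c, hc⟩ := LindemannWeierstrass.exp_polynomial_approx f hf0
  obtain ⟨p, hpp, hpm, hlt⟩ := exists_prime_mul_pow_div_factorial_lt_one
    ((f.eval 0).natAbs + l.natAbs + b.natAbs) (∑ x ∈ s, |(w x : ℝ)|) (|(l : ℝ)| ^ f.natDegree * c)
  obtain ⟨n, hn, g, hg, happ⟩ := hc p (by omega) hpp
  set N := p * f.natDegree
  obtain ⟨m, hm⟩ := exists_int_cast_eq_sum_of_invariant s (fun x => w x * ((l : K) ^ N * aeval x g))
    hs (fun σ x _ => by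
      simpa [hw] using .inl (.inl (map_aeval_int (σ : K →+* K) x g).symm))
    (fun x hx => (isIntegral_algebraMap (R := ℤ) (A := K)).mul
      (isIntegral_pow_mul_aeval f g (hf x hx) (hg.trans (Nat.sub_le _ _))))
  have hp' : Prime (p : ℤ) := Nat.prime_iff_prime_int.mp hpp
  have hnd {a : ℤ} (ha : a ≠ 0) (hap : a.natAbs < p) : ¬ (p : ℤ) ∣ a := fun hd =>
    absurd (Nat.le_of_dvd (Int.natAbs_pos.mpr ha) (Int.natCast_dvd.mp hd)) (by omega)
  have hne : l ^ N * n * b + p * m ≠ 0 := fun h0 => by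
    have hd : (p : ℤ) ∣ l ^ N * n * b :=
      (Int.dvd_iff_dvd_of_dvd_add (by rw [h0]; exact dvd_zero _)).mpr (dvd_mul_right _ _)
    rcases hp'.dvd_or_dvd hd with hd | hd
    · rcases hp'.dvd_or_dvd hd with hd | hd
      · exact hnd hl0 (by omega) (hp'.dvd_of_dvd_pow hd)
      · exact hn hd
    · exact hnd hb (by omega) hd
  have hone : (1 : ℝ) ≤ ‖((l ^ N * n * b + p * m : ℤ) : ℂ)‖ := by
    rw [Complex.norm_intCast]
    exact_mod_cast Int.one_le_abs hne
  refine absurd hone (not_le.mpr (lt_of_le_of_lt ?_ hlt))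
  have hmC : (m : ℂ) = ∑ x ∈ s, w x * ((l : ℂ) ^ N * aeval (ι x) g) := by
    have := congrArg ι hm
    simpa [map_aeval_int] using this
  have hbC : (b : ℂ) = -∑ x ∈ s, w x * Complex.exp (ι x) := eq_neg_of_add_eq_zero_left h
  have key : ((l ^ N * n * b + p * m : ℤ) : ℂ) =
      -∑ x ∈ s, w x * ((l : ℂ) ^ N * (n • Complex.exp (ι x) - p • aeval (ι x) g)) := by
    push_cast
    rw [hbC, hmC, mul_neg, Finset.mul_sum, Finset.mul_sum, neg_add_eq_sub,
      ← Finset.sum_sub_distrib, ← Finset.sum_neg_distrib]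
    refine Finset.sum_congr rfl fun x _ => ?_
    simp only [zsmul_eq_mul, nsmul_eq_mul]
    ring
  rw [key, norm_neg, Finset.sum_mul]
  refine (norm_sum_le _ _).trans (Finset.sum_le_sum fun x hx => ?_)
  rw [norm_mul, norm_mul, Complex.norm_intCast, norm_pow, Complex.norm_intCast]
  refine mul_le_mul_of_nonneg_left ?_ (abs_nonneg _)
  rw [mul_pow, ← pow_mul, mul_comm f.natDegree, mul_div_assoc]
  refine mul_le_mul_of_nonneg_left (happ ?_) (by positivity)
  rw [mem_aroots]
  exact ⟨hfne, by rw [← map_aeval_int, hf x hx, map_zero]⟩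


/-- The algebra homomorphism from the group algebra of `K` to `ℂ` sending the basis element of `x` to
`exp (ι x)`. -/
noncomputable def expLift {K : Type*} [Field K] (ι : K →+* ℂ) : AddMonoidAlgebra ℚ K →ₐ[ℚ] ℂ :=
  AddMonoidAlgebra.lift ℚ ℂ K
    { toFun := fun x => Complex.exp (ι x.toAdd)
      map_one' := by simp
      map_mul' := fun x y => by simp [Complex.exp_add] }

theorem expLift_apply {K : Type*} [Field K] (ι : K →+* ℂ) (y : AddMonoidAlgebra ℚ K) :
    expLift ι y = y.coeff.sum fun x a => a • Complex.exp (ι x) :=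
  AddMonoidAlgebra.lift_apply _ _

/-- A Galois-invariant element of the kernel of `expLift ι` has zero constant coefficient. -/
theorem coeff_zero_eq_zero_of_invariant {K : Type*} [Field K] [Algebra ℚ K]
    [FiniteDimensional ℚ K] [IsGalois ℚ K] (ι : K →+* ℂ) (y : AddMonoidAlgebra ℚ K)
    (hy : ∀ (σ : K ≃ₐ[ℚ] K) (x : K), y.coeff (σ x) = y.coeff x) (h : expLift ι y = 0) :
    y.coeff 0 = 0 := by
  classical
  obtain ⟨d, hd⟩ := IsLocalization.exist_integer_multiples_of_finset (nonZeroDivisors ℤ)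
    (insert 0 (y.coeff.support.image y.coeff))
  have hd' (x : K) : ∃ m : ℤ, (m : ℚ) = (d : ℤ) * y.coeff x := by
    have : y.coeff x ∈ insert 0 (y.coeff.support.image y.coeff) := by
      by_cases hx : y.coeff x = 0
      · simp [hx]
      · exact Finset.mem_insert_of_mem (Finset.mem_image_of_mem _ (Finsupp.mem_support_iff.mpr hx))
    obtain ⟨m, hm⟩ := hd _ this
    exact ⟨m, by simpa using hm⟩
  choose w hw using hd'
  have hd0 : ((d : ℤ) : ℚ) ≠ 0 := by exact_mod_cast nonZeroDivisors.coe_ne_zero d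
  have hw0 := eq_zero_of_sum_exp_eq_zero_of_invariant ι (y.coeff.support.erase 0) (by simp) w
    (fun σ x hx => by simpa [hy] using hx)
    (fun σ x => by
      have : (w (σ x) : ℚ) = w x := by rw [hw, hw, hy]
      exact_mod_cast this) (w 0) (by
      have hwC (x : K) : (w x : ℂ) = (d : ℤ) * (y.coeff x : ℂ) := by
        exact_mod_cast congrArg (Rat.cast : ℚ → ℂ) (hw x)
      have h0 : (w 0 : ℂ) = w 0 * Complex.exp (ι 0) := by simp
      rw [h0]
      have : ∑ x ∈ insert 0 (y.coeff.support.erase 0), (w x : ℂ) * Complex.exp (ι x) = 0 := by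
        calc _ = ∑ x ∈ y.coeff.support, (w x : ℂ) * Complex.exp (ι x) := by
              symm
              apply Finset.sum_subset
              · intro x hx
                by_cases hx0 : x = 0 <;> simp_all
              · intro x _ hx
                rw [hwC, Finsupp.notMem_support_iff.mp hx]
                simp
          _ = (d : ℤ) * expLift ι y := by
              rw [expLift_apply, Finsupp.sum, Finset.mul_sum]
              refine Finset.sum_congr rfl fun x _ => ?_
              rw [hwC, Rat.smul_def, mul_assoc]
          _ = 0 := by rw [h, mul_zero]
      rwa [Finset.sum_insert (by simp)] at this)
  have := hw 0
  rw [hw0, Int.cast_zero] at this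
  exact (mul_eq_zero.mp this.symm).resolve_left hd0

theorem expLift_injective {K : Type*} [Field K] [Algebra ℚ K]
    [FiniteDimensional ℚ K] [IsGalois ℚ K] (ι : K →+* ℂ) : Function.Injective (expLift ι) := by
  rw [injective_iff_map_eq_zero]
  intro x hx
  by_contra hx0
  let τ (σ : K ≃ₐ[ℚ] K) : AddMonoidAlgebra ℚ K ≃+* AddMonoidAlgebra ℚ K :=
    AddMonoidAlgebra.mapDomainRingEquiv ℚ (σ : K ≃+ K)
  have hτc (σ : K ≃ₐ[ℚ] K) (y) (a : K) : (τ σ y).coeff (σ a) = y.coeff a := by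
    simp [τ, AddMonoidAlgebra.coeff_mapDomainRingEquiv]
  have hinv_of_map {y : AddMonoidAlgebra ℚ K} (h : ∀ σ, τ σ y = y) (σ : K ≃ₐ[ℚ] K) (a : K) :
      y.coeff (σ a) = y.coeff a := by
    conv_lhs => rw [← h σ]
    exact hτc σ y a
  have hτmul (σ ρ : K ≃ₐ[ℚ] K) (y) : τ σ (τ ρ y) = τ (σ * ρ) y := by
    ext a
    obtain ⟨a, rfl⟩ := (σ * ρ).surjective a
    rw [hτc, AlgEquiv.mul_apply, hτc, hτc]
  let y := ∏ σ : K ≃ₐ[ℚ] K, τ σ x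
  have hy0 : y ≠ 0 := Finset.prod_ne_zero_iff.mpr fun σ _ => by simpa using hx0
  have hyτ (σ) : τ σ y = y := by
    rw [map_prod]
    simp_rw [hτmul]
    exact Fintype.prod_equiv (Equiv.mulLeft σ) _ _ fun _ => rfl
  have hy : expLift ι y = 0 := by
    rw [map_prod]
    refine Finset.prod_eq_zero (Finset.mem_univ 1) ?_
    convert hx using 2
    ext a
    exact hτc 1 x a
  obtain ⟨β, hβ⟩ : ∃ β, y.coeff β ≠ 0 := by
    by_contra! h
    exact hy0 (by ext a; simpa using h a)
  let z := ∑ σ : K ≃ₐ[ℚ] K, τ σ (.single (-β) 1)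
  have hzτ (σ) : τ σ z = z := by
    rw [map_sum]
    simp_rw [hτmul]
    exact Fintype.sum_equiv (Equiv.mulLeft σ) _ _ fun _ => rfl
  have h0 := coeff_zero_eq_zero_of_invariant ι (y * z)
    (hinv_of_map fun σ => by rw [map_mul, hyτ, hzτ]) (by rw [map_mul, hy, zero_mul])
  have hcoeff (σ : K ≃ₐ[ℚ] K) : (y * τ σ (.single (-β) 1)).coeff 0 = y.coeff β := by
    rw [← hinv_of_map hyτ σ β]
    have : τ σ (.single (-β) 1) = .single (-σ β) 1 := by
      simp [τ, -AddEquiv.coe_toAddMonoidHom]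
      rfl
    rw [this]
    simp
  rw [Finset.mul_sum, AddMonoidAlgebra.coeff_sum, Finsupp.finsetSum_apply] at h0
  simp only [hcoeff] at h0
  simp [hβ] at h0

/-- The Lindemann–Weierstrass theorem over `ℚ`: exponentials of distinct algebraic numbers are
linearly independent. -/
theorem linearIndependent_exp {κ : Type*} {a : κ → ℂ} (ha : ∀ k, IsAlgebraic ℚ (a k))
    (hinj : Function.Injective a) : LinearIndependent ℚ fun k => Complex.exp (a k) := by
  classical
  rw [linearIndependent_iff']
  intro s g hg k hk
  let q : ℚ[X] := ∏ j ∈ s, minpoly ℚ (a j)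
  have hq0 : q ≠ 0 := Finset.prod_ne_zero_iff.mpr fun j _ => minpoly.ne_zero (ha j).isIntegral
  let K := IntermediateField.adjoin ℚ (q.rootSet ℂ)
  have : q.IsSplittingField ℚ K :=
    IntermediateField.adjoin_rootSet_isSplittingField (IsAlgClosed.splits _)
  have : FiniteDimensional ℚ K := IsSplittingField.finiteDimensional K q
  have : Normal ℚ K := Normal.of_isSplittingField q
  have : IsGalois ℚ K := ⟨⟩
  have hmem (j) (hj : j ∈ s) : ∃ b : K, (b : ℂ) = a j :=
    ⟨⟨a j, IntermediateField.subset_adjoin _ _ ((mem_rootSet_of_ne hq0).mpr (by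
      rw [map_prod]
      exact Finset.prod_eq_zero hj (minpoly.aeval ℚ _)))⟩, rfl⟩
  choose! b hb using hmem
  let x : AddMonoidAlgebra ℚ K := ∑ j ∈ s, .single (b j) (g j)
  have hx : x = 0 := by
    apply expLift_injective (algebraMap K ℂ)
    rw [map_sum, map_zero, ← hg]
    refine Finset.sum_congr rfl fun j hj => ?_
    rw [expLift_apply, AddMonoidAlgebra.coeff_single, Finsupp.sum_single_index (by simp)]
    exact congrArg (fun z => g j • Complex.exp z) (hb j hj)
  have hxk : x.coeff (b k) = g k := by
    rw [AddMonoidAlgebra.coeff_sum, Finsupp.finsetSum_apply, Finset.sum_eq_single_of_mem k hk]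
    · simp
    · intro j hj hjk
      have : b j ≠ b k := fun h => hjk (hinj (by rw [← hb j hj, ← hb k hk, h]))
      simp [this]
  rw [← hxk, hx]
  simp

/-- The Lindemann–Weierstrass theorem: exponentials of linearly independent algebraic numbers are
algebraically independent. -/
theorem algebraicIndependent_exp {κ : Type*} {a : κ → ℂ} (ha : ∀ k, IsAlgebraic ℚ (a k))
    (hlin : LinearIndependent ℚ a) : AlgebraicIndependent ℚ fun k => Complex.exp (a k) := by
  have hinj : Function.Injective (Finsupp.linearCombination ℕ a) :=
    hlin.restrict_scalars' ℕ
  have halg (m : κ →₀ ℕ) : IsAlgebraic ℚ (Finsupp.linearCombination ℕ a m) := by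
    rw [Finsupp.linearCombination_apply]
    exact (IsIntegral.sum _ fun k _ => (ha k).isIntegral.smul _).isAlgebraic
  have hexp := linearIndependent_exp halg hinj
  rw [linearIndependent_iff'] at hexp
  rw [algebraicIndependent_iff]
  intro p hp
  rw [MvPolynomial.aeval_def, MvPolynomial.eval₂_eq] at hp
  have hcoeff := hexp p.support (fun m => p.coeff m) (by
    rw [← hp]
    refine Finset.sum_congr rfl fun m _ => ?_
    rw [Algebra.smul_def, Finsupp.linearCombination_apply, Finsupp.sum, Complex.exp_sum]
    simp [← Complex.exp_nat_mul])
  ext m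
  by_cases hm : m ∈ p.support
  · simpa using hcoeff m hm
  · simpa using hm

/-- An irrational square root of an element of the base field has trace zero. -/
theorem trace_eq_zero_of_sq_eq {F L : Type*} [Field F] [Field L] [Algebra F L]
    [FiniteDimensional F L] {x : L} {d : F} (hx : x ^ 2 = algebraMap F L d)
    (hmem : x ∉ (algebraMap F L).range) : Algebra.trace F L x = 0 := by
  have hint : IsIntegral F x := .of_finite F x
  have hmin : minpoly F x = X ^ 2 - C d := by
    refine (eq_of_monic_of_dvd_of_natDegree_le (minpoly.monic hint)
      (monic_X_pow_sub_C d two_ne_zero) (minpoly.dvd F x (by simp [hx])) ?_).symm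
    rw [natDegree_X_pow_sub_C]
    exact (minpoly.two_le_natDegree_iff hint).mpr hmem
  rw [trace_eq_finrank_mul_minpoly_nextCoeff, hmin, nextCoeff_of_natDegree_pos (by simp)]
  simp

theorem irrational_sqrt_mul_sqrt {p q : ℕ} (hp : p.Prime) (hq : q.Prime) (hpq : p ≠ q) :
    Irrational (√(p : ℝ) * √(q : ℝ)) := by
  rw [← Real.sqrt_mul (Nat.cast_nonneg p), ← Nat.cast_mul, irrational_sqrt_natCast_iff]
  rintro ⟨r, hr⟩
  have hpr : p ∣ r := or_self_iff.mp (hp.dvd_mul.mp (hr ▸ dvd_mul_right p q))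
  obtain ⟨t, rfl⟩ := hpr
  have hqt : q = p * (t * t) := Nat.eq_of_mul_eq_mul_left hp.pos (by rw [hr]; ring)
  exact hpq ((Nat.prime_dvd_prime_iff_eq hp hq).mp ⟨_, hqt⟩)

/-- The square roots of the primes are linearly independent over `ℚ`. -/
theorem linearIndependent_sqrt_primes :
    LinearIndependent ℚ fun p : {p : ℕ // p.Prime} => √(p : ℝ) := by
  rw [linearIndependent_iff']
  intro s g hg k hk
  let K := IntermediateField.adjoin ℚ ((fun p : {p : ℕ // p.Prime} => √(p : ℝ)) '' s)
  have hint (p : {p : ℕ // p.Prime}) : IsIntegral ℚ (√(p : ℝ)) :=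
    .of_pow two_pos (by
      rw [Real.sq_sqrt (Nat.cast_nonneg _)]
      exact isIntegral_algebraMap (x := (p : ℚ)))
  have : FiniteDimensional ℚ K := IntermediateField.finiteDimensional_adjoin
    (Set.forall_mem_image.mpr fun p _ => hint p)
  have hmem (p) (hp : p ∈ s) : ∃ b : K, (b : ℝ) = √(p : ℝ) :=
    ⟨⟨_, IntermediateField.subset_adjoin _ _ ⟨p, hp, rfl⟩⟩, rfl⟩
  choose! b hb using hmem
  have hsq (p) (hp : p ∈ s) : b p ^ 2 = algebraMap ℚ K (p : ℕ) := by
    apply Subtype.ext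
    simp [hb p hp]
  have htr (p) (hp : p ∈ s) (hpk : p ≠ k) : Algebra.trace ℚ K (b p * b k) = 0 := by
    refine trace_eq_zero_of_sq_eq (d := (p : ℕ) * (k : ℕ)) ?_ ?_
    · rw [mul_pow, hsq p hp, hsq k hk, map_mul]
    · rintro ⟨q, hq⟩
      refine irrational_sqrt_mul_sqrt p.2 k.2 (Subtype.coe_ne_coe.mpr hpk) ⟨q, ?_⟩
      rw [← hb p hp, ← hb k hk]
      simpa using congrArg (Subtype.val : K → ℝ) hq
  have hsum : ∑ p ∈ s, g p • b p = 0 := by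
    apply K.val.injective
    rw [map_sum, map_zero, ← hg]
    exact Finset.sum_congr rfl fun p hp => by
      rw [← hb p hp]
      rfl
  have h := congrArg (fun x => Algebra.trace ℚ K (x * b k)) hsum
  simp only [Finset.sum_mul, map_sum, smul_mul_assoc, map_smul, zero_mul, map_zero] at h
  rw [Finset.sum_eq_single_of_mem k hk fun p hp hpk => by rw [htr p hp hpk, smul_zero], ← sq,
    hsq k hk, Algebra.trace_algebraMap] at h
  simpa [Module.finrank_pos.ne', k.2.ne_zero] using h

end LindemannWeierstrass

theorem stmt_12 :
    AlgebraicIndependent ℚ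
      (fun p : {p : ℕ // p.Prime} =>
        Complex.exp (Complex.I * (Real.sqrt p : ℝ))) := by
  refine LindemannWeierstrass.algebraicIndependent_exp (fun p => ?_) ?_
  · refine IsAlgebraic.of_pow two_pos ?_
    have : (Complex.I * (√(p : ℝ) : ℝ)) ^ 2 = algebraMap ℚ ℂ (-(p : ℕ)) := by
      rw [mul_pow, Complex.I_sq, ← Complex.ofReal_pow, Real.sq_sqrt (Nat.cast_nonneg _)]
      simp
    rw [this]
    exact isAlgebraic_algebraMap _
  · let f : ℝ →ₗ[ℚ] ℂ :=
      LinearMap.mulLeft ℚ Complex.I ∘ₗ Complex.ofRealAm.toLinearMap.restrictScalars ℚ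
    exact LindemannWeierstrass.linearIndependent_sqrt_primes.map' f
      (LinearMap.ker_eq_bot.mpr fun x y h => by simpa [f] using h)
end

section
/- Let $p$ be a nonconstant irreducible polynomial with rational coefficients whose Galois group is abelian. Then either every complex root of $p$ is real, or no complex root of $p$ is real. -/
open Polynomial

theorem stmt_13 (p : ℚ[X]) (hirr : Irreducible p) (hdeg : 0 < p.natDegree)
    (hab : ∀ σ τ : p.Gal, σ * τ = τ * σ) :
    (∀ z : ℂ, aeval z p = 0 → z.im = 0) ∨ (∀ z : ℂ, aeval z p = 0 → z.im ≠ 0) := by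
  by_contra! h
  obtain ⟨⟨z, hz, hzim⟩, w, hw, hwim⟩ := h
  have : Fact ((p.map (algebraMap ℚ ℂ)).Splits) := ⟨IsAlgClosed.splits _⟩
  let conj : Gal(ℂ/ℚ) := Complex.conjAe.restrictScalars ℚ
  let c : p.Gal := Gal.restrict p ℂ conj
  let z' : p.rootSet ℂ := ⟨z, mem_rootSet.2 ⟨hirr.ne_zero, hz⟩⟩
  let w' : p.rootSet ℂ := ⟨w, mem_rootSet.2 ⟨hirr.ne_zero, hw⟩⟩
  have hc (x : p.rootSet ℂ) : c • x = x ↔ (x : ℂ).im = 0 := by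
    rw [Subtype.ext_iff, Gal.restrict_smul]
    exact Complex.conj_eq_iff_im
  have := Gal.galAction_isPretransitive p ℂ hirr
  obtain ⟨g, hg⟩ := MulAction.exists_smul_eq p.Gal w' z'
  refine hzim ((hc z').1 ?_)
  rw [← hg, ← mul_smul, hab, mul_smul, (hc w').2 hwim]
end

section
/- For every prime natural number $p$ and every integer $n \geq 3$, the Galois group of the polynomial $x^n - p$ over the rational numbers is not abelian: there exist elements $\sigma, \tau$ of the Galois group of its splitting field over $\mathbb{Q}$ with $\sigma\tau \neq \tau\sigma$. -/
open Polynomial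

theorem irreducible_X_pow_sub_C_natCast_prime {p : ℕ} (hp : p.Prime) {n : ℕ} (hn : n ≠ 0) :
    Irreducible (X ^ n - C (p : ℚ) : ℚ[X]) := by
  have hpZ : Prime (p : ℤ) := Nat.prime_iff_prime_int.mp hp
  have hmonic : (X ^ n - C (p : ℤ) : ℤ[X]).Monic := monic_X_pow_sub_C _ hn
  have hdeg : (X ^ n - C (p : ℤ) : ℤ[X]).degree = n :=
    degree_X_pow_sub_C (Nat.pos_of_ne_zero hn) _
  have hirr : Irreducible (X ^ n - C (p : ℤ) : ℤ[X]) := by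
    refine irreducible_of_eisenstein_criterion (P := Ideal.span {(p : ℤ)})
      ((Ideal.span_singleton_prime hpZ.ne_zero).mpr hpZ) ?_ ?_ ?_ ?_ hmonic.isPrimitive
    · rw [hmonic.leadingCoeff, Ideal.mem_span_singleton]
      exact fun h => hpZ.not_isUnit (isUnit_of_dvd_one h)
    · intro m hm
      rw [hdeg] at hm
      have hm' : m ≠ n := (Nat.cast_lt.mp hm).ne
      rw [Ideal.mem_span_singleton, coeff_sub, coeff_X_pow, if_neg hm', coeff_C]
      split_ifs <;> simp
    · rw [hdeg]
      exact_mod_cast Nat.pos_of_ne_zero hn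
    · rw [Ideal.span_singleton_pow, Ideal.mem_span_singleton, coeff_sub, coeff_X_pow,
        if_neg hn.symm, coeff_C_zero, zero_sub, dvd_neg, sq]
      intro h
      exact hpZ.not_isUnit (isUnit_of_dvd_one
        ((mul_dvd_mul_iff_left hpZ.ne_zero).mp (by simpa using h)))
  have := (hmonic.irreducible_iff_irreducible_map_fraction_map (K := ℚ)).mp hirr
  simpa using this

/-- If the Galois group of an irreducible polynomial is commutative, then an automorphism fixing
one root fixes every root. -/
theorem Polynomial.Gal.apply_eq_of_mem_rootSet_of_mul_comm {F E : Type*} [Field F] [Field E]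
    [Algebra F E] {f : F[X]} (hf : Irreducible f) (hs : (f.map (algebraMap F E)).Splits)
    (hcomm : ∀ σ τ : f.Gal, σ * τ = τ * σ) (φ : E ≃ₐ[F] E) {x y : E}
    (hx : x ∈ f.rootSet E) (hy : y ∈ f.rootSet E) (hφ : φ x = x) : φ y = y := by
  have : Fact (f.map (algebraMap F E)).Splits := ⟨hs⟩
  have := Gal.galAction_isPretransitive f E hf
  obtain ⟨g, hg⟩ := MulAction.exists_smul_eq f.Gal (⟨x, hx⟩ : f.rootSet E) ⟨y, hy⟩
  have hfix : Gal.restrict f E φ • (⟨x, hx⟩ : f.rootSet E) = ⟨x, hx⟩ :=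
    Subtype.ext ((Gal.restrict_smul φ _).trans hφ)
  have hfix' : Gal.restrict f E φ • (⟨y, hy⟩ : f.rootSet E) = ⟨y, hy⟩ := by
    rw [← hg, ← mul_smul, hcomm, mul_smul, hfix]
  exact (Gal.restrict_smul φ (⟨y, hy⟩ : f.rootSet E)).symm.trans (congrArg Subtype.val hfix')

theorem stmt_14 (p : ℕ) (hp : p.Prime) (n : ℕ) (hn : 3 ≤ n) :
    ∃ σ τ : (X ^ n - C (p : ℚ) : ℚ[X]).Gal, σ * τ ≠ τ * σ := by
  by_contra! hcomm
  have hn0 : n ≠ 0 := by omega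
  have hirr := irreducible_X_pow_sub_C_natCast_prime hp hn0
  have hmem : ∀ z : ℂ, z ^ n = p → z ∈ (X ^ n - C (p : ℚ) : ℚ[X]).rootSet ℂ := by
    intro z hz
    rw [mem_rootSet]
    exact ⟨hirr.ne_zero, by simp [hz]⟩
  have hp0 : (0 : ℝ) < p := by exact_mod_cast hp.pos
  set a : ℝ := (p : ℝ) ^ (n : ℝ)⁻¹
  have ha0 : (a : ℂ) ≠ 0 := by exact_mod_cast (Real.rpow_pos_of_pos hp0 _).ne'
  have han : (a : ℂ) ^ n = p := by
    exact_mod_cast Real.rpow_inv_natCast_pow hp0.le hn0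
  have hζ := Complex.isPrimitiveRoot_exp n hn0
  set ζ : ℂ := Complex.exp (2 * Real.pi * Complex.I / n)
  have hfix := Polynomial.Gal.apply_eq_of_mem_rootSet_of_mul_comm hirr
    (IsAlgClosed.splits _) hcomm (Complex.conjAe.restrictScalars ℚ)
    (hmem a han) (hmem (a * ζ) (by rw [mul_pow, han, hζ.pow_eq_one, mul_one]))
    (Complex.conj_ofReal a)
  have hconj : (starRingEnd ℂ) ζ = ζ := by
    have : (starRingEnd ℂ) (a * ζ) = a * ζ := hfix
    rw [map_mul, Complex.conj_ofReal] at this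
    exact mul_left_cancel₀ ha0 this
  have hsq : ζ ^ 2 = 1 := by
    have hnorm : ‖ζ‖ = 1 := hζ.norm'_eq_one hn0
    have := Complex.mul_conj ζ
    rw [hconj, Complex.normSq_eq_norm_sq, hnorm] at this
    rw [sq, this]; simp
  have := Nat.le_of_dvd two_pos (hζ.dvd_of_pow_eq_one 2 hsq)
  omega
end
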